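/- Let X be a metric space, L a subset of X, d ≥ 1, and B : X → (ℝ^d →L[ℝ] ℝ^d) a continuous map such that B x is injective for every x ∈ X. Let E assign to each x ∈ L a nonzero linear subspace E x of ℝ^d, and assume that the family E is sequentially upper semicontinuous on L. Then the function γ : L → ℝ defined by γ x = sup { Real.log ‖(B x) u‖ : u ∈ E x, ‖u‖ = 1 } is upper semicontinuous on L; that is, for every ω ∈ ℝ the set { x ∈ L : γ x < ω } is open in the subspace topology of L. -/

import Mathlib

/-- On a nonzero subspace, the logarithmic growth of an injective operator attains its maximum
over the unit vectors. -/
theorem exists_isGreatest_log_norm_apply {V W : Type*} [NormedAddCommGroup V] [NormedSpace ℝ V]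
    [FiniteDimensional ℝ V] [NormedAddCommGroup W] [NormedSpace ℝ W]
    (A : V →L[ℝ] W) (hA : Function.Injective A) (F : Submodule ℝ V) (hF : F ≠ ⊥) :
    ∃ a, IsGreatest {r : ℝ | ∃ u ∈ F, ‖u‖ = 1 ∧ r = Real.log ‖A u‖} a := by
  have := FiniteDimensional.proper ℝ V
  have hK : IsCompact (Metric.sphere (0 : V) 1 ∩ F) :=
    (isCompact_sphere 0 1).inter_right F.closed_of_finiteDimensional
  obtain ⟨v, hvF, hv⟩ := F.exists_mem_ne_zero_of_ne_bot hF
  have hne : (Metric.sphere (0 : V) 1 ∩ F).Nonempty :=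
    ⟨‖v‖⁻¹ • v, by simp [norm_smul, hv], F.smul_mem _ hvF⟩
  have hcont : ContinuousOn (fun u => Real.log ‖A u‖) (Metric.sphere (0 : V) 1 ∩ F) := by
    refine A.continuous.norm.continuousOn.log fun u hu => ?_
    have hu0 : u ≠ 0 := ne_zero_of_mem_unit_sphere ⟨u, hu.1⟩
    simpa using (map_ne_zero_iff A hA).2 hu0
  obtain ⟨u, ⟨hu1, huF⟩, hmax⟩ := hK.exists_isMaxOn hne hcont
  refine ⟨_, ⟨u, huF, by simpa using hu1, rfl⟩, ?_⟩
  rintro _ ⟨w, hwF, hw1, rfl⟩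
  exact hmax ⟨by simpa using hw1, hwF⟩

/-- If `B : X → (ℝ^d →L[ℝ] ℝ^d)` is continuous with each `B x` injective,
`E` assigns to each `x ∈ L` a nonzero subspace of `ℝ^d`, and the family `E` is sequentially
upper semicontinuous on `L`, then `γ x = sup { log ‖B x u‖ : u ∈ E x, ‖u‖ = 1 }` is upper
semicontinuous on `L`: every strict sublevel set of `γ` in `L` is open in the subspace
topology of `L`. -/
theorem oseledets_sup_log_upperSemicontinuous
    {X : Type*} [MetricSpace X] (L : Set X) (d : ℕ) (hd : 1 ≤ d)
    (B : X → (EuclideanSpace ℝ (Fin d) →L[ℝ] EuclideanSpace ℝ (Fin d)))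
    (hBcont : Continuous B)
    (hBinj : ∀ x : X, Function.Injective (B x))
    (E : X → Submodule ℝ (EuclideanSpace ℝ (Fin d)))
    (hEne : ∀ x ∈ L, E x ≠ ⊥)
    (hEusc : ∀ x ∈ L, ∀ xs : ℕ → X, (∀ m, xs m ∈ L) →
      Filter.Tendsto xs Filter.atTop (nhds x) →
      ∀ us : ℕ → EuclideanSpace ℝ (Fin d),
        (∀ m, us m ∈ E (xs m)) → (∀ m, ‖us m‖ = 1) →
        ∀ u : EuclideanSpace ℝ (Fin d),
          Filter.Tendsto us Filter.atTop (nhds u) → u ∈ E x)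
    (γ : X → ℝ)
    (hγ : ∀ x ∈ L, γ x = sSup {r : ℝ | ∃ u ∈ E x, ‖u‖ = 1 ∧ r = Real.log ‖B x u‖}) :
    ∀ ω : ℝ, ∃ U : Set X, IsOpen U ∧ {x ∈ L | γ x < ω} = U ∩ L := by
  intro ω
  have hgreat : ∀ x ∈ L, IsGreatest
      {r : ℝ | ∃ u ∈ E x, ‖u‖ = 1 ∧ r = Real.log ‖B x u‖} (γ x) := by
    intro x hx
    obtain ⟨a, ha⟩ := exists_isGreatest_log_norm_apply (B x) (hBinj x) (E x) (hEne x hx)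
    rwa [hγ x hx, ha.csSup_eq]
  suffices hclosed : IsClosed {x : L | ω ≤ γ x} by
    obtain ⟨U, hU, hUL⟩ := isOpen_induced_iff.1 hclosed.isOpen_compl
    refine ⟨U, hU, ?_⟩
    ext x
    have hmem (hx : x ∈ L) : x ∈ U ↔ γ x < ω := by
      simpa using Set.ext_iff.1 hUL ⟨x, hx⟩
    constructor
    · exact fun h => ⟨(hmem h.1).2 h.2, h.1⟩
    · exact fun h => ⟨h.2, (hmem h.2).1 h.1⟩
  refine IsSeqClosed.isClosed fun xs x hxs hlim => ?_
  choose us husE hus1 hus using fun m => (hgreat (xs m) (xs m).2).1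
  obtain ⟨u, hu, φ, hφ, hφu⟩ := (isCompact_sphere (0 : EuclideanSpace ℝ (Fin d)) 1).tendsto_subseq
    (x := us) (fun m => by simpa using hus1 m)
  have hu1 : ‖u‖ = 1 := by simpa using hu
  have hxφ : Filter.Tendsto (fun m => (xs (φ m) : X)) Filter.atTop (nhds (x : X)) :=
    (continuous_subtype_val.tendsto x).comp (hlim.comp hφ.tendsto_atTop)
  have huE : u ∈ E x := hEusc x x.2 _ (fun m => (xs (φ m)).2) hxφ _ (fun m => husE (φ m))
    (fun m => hus1 (φ m)) u hφu
  have hBu : ‖B x u‖ ≠ 0 := by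
    have hu0 : u ≠ 0 := ne_zero_of_mem_unit_sphere ⟨u, hu⟩
    simpa using (map_ne_zero_iff (B x) (hBinj x)).2 hu0
  have happly : Continuous fun p : X × EuclideanSpace ℝ (Fin d) => B p.1 p.2 :=
    (hBcont.comp continuous_fst).clm_apply continuous_snd
  have hlog : Filter.Tendsto (fun m => Real.log ‖B (xs (φ m)) (us (φ m))‖) Filter.atTop
      (nhds (Real.log ‖B x u‖)) :=
    ((happly.tendsto ((x : X), u)).comp (hxφ.prodMk_nhds hφu)).norm.log hBu
  have hω : ω ≤ Real.log ‖B x u‖ :=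
    ge_of_tendsto' hlog fun m => (hxs (φ m)).trans_eq (hus (φ m))
  exact hω.trans ((hgreat x x.2).2 ⟨u, huE, hu1, rfl⟩)
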